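/- Let P be a convex polytope in ℝⁿ (n ≥ 2) whose affine span Φ is a hyperplane, with P ≠ Φ. Let R > 0 and let x, y ∈ ∂N_R(P) lie on opposite sides of Φ, with projections x₀, y₀ on P and projections x', y' on Φ such that [x',y'] meets P. Let z ∈ ∂P minimize d(x₀,t) + d(t,y₀) over t ∈ ∂P. Then there exist universal constants k₁, k₂ > 0 with k₁ · (d(x,y) + d(x₀,z) + d(z,y₀)) ≤ d_ℓ(x,y) ≤ k₂ · (d(x,y) + d(x₀,z) + d(z,y₀)), where d_ℓ is the length metric on ∂N_R(P). -/

import Mathlib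

open Metric
open scoped ENNReal RealInnerProductSpace

/-- The length (intrinsic) metric on a subset `S` of a metric space. -/
noncomputable def lengthDist {E : Type*} [MetricSpace E] (S : Set E) (x y : E) : ℝ≥0∞ :=
  ⨅ (γ : ℝ → E) (_ : ContinuousOn γ (Set.Icc 0 1)) (_ : γ 0 = x) (_ : γ 1 = y)
    (_ : ∀ t ∈ Set.Icc (0:ℝ) 1, γ t ∈ S), eVariationOn γ (Set.Icc 0 1)

/-- A convex polyhedron: an intersection of finitely many closed half-spaces. -/
def IsPolyhedron {n : ℕ} (P : Set (EuclideanSpace ℝ (Fin n))) : Prop :=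
  ∃ (k : ℕ) (v : Fin k → EuclideanSpace ℝ (Fin n)) (c : Fin k → ℝ),
    P = {x | ∀ i, ⟪v i, x⟫ ≤ c i}

open Set

section LengthDist

variable {E : Type*} [MetricSpace E] {S : Set E}

lemma lengthDist_le {x y : E} {γ : ℝ → E} (hc : ContinuousOn γ (Icc 0 1)) (h0 : γ 0 = x)
    (h1 : γ 1 = y) (hS : ∀ t ∈ Icc (0 : ℝ) 1, γ t ∈ S) :
    lengthDist S x y ≤ eVariationOn γ (Icc 0 1) :=
  iInf_le_of_le γ <| iInf_le_of_le hc <| iInf_le_of_le h0 <| iInf_le_of_le h1 <|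
    iInf_le_of_le hS le_rfl

lemma lengthDist_le_of_lipschitz {x y : E} {γ : ℝ → E} {K : ℝ} (hK : 0 ≤ K)
    (hγ : ∀ s ∈ Icc (0 : ℝ) 1, ∀ t ∈ Icc (0 : ℝ) 1, dist (γ s) (γ t) ≤ K * dist s t)
    (h0 : γ 0 = x) (h1 : γ 1 = y) (hS : ∀ t ∈ Icc (0 : ℝ) 1, γ t ∈ S) :
    lengthDist S x y ≤ ENNReal.ofReal K := by
  have hL : LipschitzOnWith K.toNNReal γ (Icc 0 1) :=
    LipschitzOnWith.of_dist_le_mul fun s hs t ht => by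
      rw [Real.coe_toNNReal K hK]
      exact hγ s hs t ht
  refine (lengthDist_le hL.continuousOn h0 h1 hS).trans ?_
  have hid : eVariationOn (id : ℝ → ℝ) (Icc 0 1) ≤ 1 := by
    simp
  calc eVariationOn γ (Icc 0 1) = eVariationOn (γ ∘ id) (Icc 0 1) := rfl
    _ ≤ K.toNNReal * eVariationOn (id : ℝ → ℝ) (Icc 0 1) :=
      hL.comp_eVariationOn_le (mapsTo_id _)
    _ ≤ K.toNNReal * 1 := by gcongr
    _ = ENNReal.ofReal K := by rw [mul_one]; rfl

lemma lengthDist_triangle (S : Set E) (x y z : E) :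
    lengthDist S x z ≤ lengthDist S x y + lengthDist S y z := by
  conv_rhs => simp only [lengthDist, ENNReal.iInf_add, ENNReal.add_iInf]
  refine le_iInf fun γ' => le_iInf fun hc' => le_iInf fun h0' => le_iInf fun h1' =>
    le_iInf fun hS' => le_iInf fun γ => le_iInf fun hc => le_iInf fun h0 => le_iInf fun h1 =>
    le_iInf fun hS => ?_
  set η : ℝ → E := fun t => if t ≤ 1 / 2 then γ (2 * t) else γ' (2 * t - 1) with hη
  have hleft : EqOn η (γ ∘ fun t => 2 * t) (Icc 0 (1 / 2)) := fun t ht => by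
    simp only [hη, Function.comp, if_pos ht.2]
  have hright : EqOn η (γ' ∘ fun t => 2 * t - 1) (Icc (1 / 2) 1) := fun t ht => by
    rcases ht.1.eq_or_lt with h | h
    · subst h
      norm_num [hη, h1, h0']
    · simp only [hη, Function.comp, if_neg h.not_ge]
  have hml : MapsTo (fun t : ℝ => 2 * t) (Icc 0 (1 / 2)) (Icc 0 1) := fun t ht =>
    ⟨by linarith [ht.1], by linarith [ht.2]⟩
  have hmr : MapsTo (fun t : ℝ => 2 * t - 1) (Icc (1 / 2) 1) (Icc 0 1) := fun t ht =>
    ⟨by linarith [ht.1], by linarith [ht.2]⟩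
  have hsplit : Icc (0 : ℝ) 1 = Icc 0 (1 / 2) ∪ Icc (1 / 2) 1 :=
    (Icc_union_Icc_eq_Icc (by norm_num) (by norm_num)).symm
  have hηc : ContinuousOn η (Icc 0 1) := by
    rw [hsplit]
    refine ContinuousOn.union_of_isClosed ?_ ?_ isClosed_Icc isClosed_Icc
    · exact (hc.comp (by fun_prop) hml).congr hleft
    · exact (hc'.comp (by fun_prop) hmr).congr hright
  have hηS : ∀ t ∈ Icc (0 : ℝ) 1, η t ∈ S := by
    intro t ht
    rw [hsplit] at ht
    rcases ht with ht | ht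
    · rw [hleft ht]
      exact hS _ (hml ht)
    · rw [hright ht]
      exact hS' _ (hmr ht)
  refine (lengthDist_le hηc (by simp [hη, h0]) (by norm_num [hη, h1']) hηS).trans ?_
  have hadd := eVariationOn.Icc_add_Icc η (s := univ) (a := (0 : ℝ)) (b := 1 / 2) (c := 1)
    (by norm_num) (by norm_num) (mem_univ _)
  simp only [univ_inter] at hadd
  rw [← hadd, eVariationOn.eq_of_eqOn hleft, eVariationOn.eq_of_eqOn hright]
  gcongr
  · exact eVariationOn.comp_le_of_monotoneOn γ _ (fun a _ b _ h => by linarith) hml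
  · exact eVariationOn.comp_le_of_monotoneOn γ' _ (fun a _ b _ h => by linarith) hmr

/-- A path passing through `γ t` is at least as long as the broken line through that point. -/
lemma edist_add_edist_le_eVariationOn (γ : ℝ → E) {t : ℝ} (ht : t ∈ Icc (0 : ℝ) 1) :
    edist (γ 0) (γ t) + edist (γ t) (γ 1) ≤ eVariationOn γ (Icc 0 1) := by
  have hadd := eVariationOn.Icc_add_Icc γ (s := univ) ht.1 ht.2 (mem_univ _)
  simp only [univ_inter] at hadd
  rw [← hadd]
  exact add_le_add
    (eVariationOn.edist_le γ (left_mem_Icc.2 ht.1) (right_mem_Icc.2 ht.1))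
    (eVariationOn.edist_le γ (left_mem_Icc.2 ht.2) (right_mem_Icc.2 ht.2))

end LengthDist

section NearestPoint

variable {E : Type*} [NormedAddCommGroup E] [InnerProductSpace ℝ E] {C : Set E}

lemma inner_sub_nonpos_of_dist_eq_infDist (hC : Convex ℝ C) {x p : E} (hp : p ∈ C)
    (h : dist x p = infDist x C) : ∀ q ∈ C, ⟪x - p, q - p⟫ ≤ 0 := by
  rw [← norm_eq_iInf_iff_real_inner_le_zero hC hp, ← dist_eq_norm, h, infDist_eq_iInf]
  simp only [dist_eq_norm]

lemma infDist_add_eq_norm {p v : E} (hp : p ∈ C) (hv : ∀ q ∈ C, ⟪v, q - p⟫ ≤ 0) :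
    infDist (p + v) C = ‖v‖ := by
  apply le_antisymm
  · simpa using infDist_le_dist_of_mem (x := p + v) hp
  · rw [le_infDist ⟨p, hp⟩]
    intro q hq
    rw [dist_eq_norm, ← sq_le_sq₀ (norm_nonneg _) (norm_nonneg _)]
    have hsq := norm_sub_sq_real v (q - p)
    rw [show p + v - q = v - (q - p) by abel]
    nlinarith [hv q hq, sq_nonneg ‖q - p‖]

lemma dist_le_dist_of_inner_nonpos {x y p q : E} (hx : ⟪x - p, q - p⟫ ≤ 0)
    (hy : ⟪y - q, p - q⟫ ≤ 0) : dist p q ≤ dist x y := by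
  have h : ‖p - q‖ * ‖p - q‖ ≤ ‖x - y‖ * ‖p - q‖ := by
    refine le_trans ?_ (real_inner_le_norm (x - y) (p - q))
    have e : ⟪x - y, p - q⟫ = ⟪p - q, p - q⟫ - ⟪x - p, q - p⟫ - ⟪y - q, p - q⟫ := by
      rw [← neg_sub p q, inner_neg_right]
      simp only [inner_sub_left]
      ring
    rw [e, real_inner_self_eq_norm_mul_norm]
    linarith
  rw [dist_eq_norm, dist_eq_norm]
  rcases (norm_nonneg (p - q)).eq_or_lt with h0 | h0
  · rw [← h0]
    exact norm_nonneg _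
  · exact le_of_mul_le_mul_right h h0

lemma mem_intrinsicFrontier_of_dist_eq_infDist (hC : Convex ℝ C) {w p : E}
    (hw : w ∈ affineSpan ℝ C) (hwC : w ∉ C) (hp : p ∈ C) (h : dist w p = infDist w C) :
    p ∈ intrinsicFrontier ℝ C := by
  rw [← intrinsicClosure_sdiff_intrinsicInterior]
  refine ⟨subset_intrinsicClosure hp, fun hint => ?_⟩
  obtain ⟨p', hp', rfl⟩ := mem_intrinsicInterior.1 hint
  have hmem : ∀ t : ℝ, AffineMap.lineMap (p' : E) w t ∈ affineSpan ℝ C := fun t =>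
    AffineMap.lineMap_mem t p'.2 hw
  let τ : ℝ → affineSpan ℝ C := fun t => ⟨AffineMap.lineMap (p' : E) w t, hmem t⟩
  have hτ : Continuous τ := AffineMap.lineMap_continuous.subtype_mk hmem
  have hτ0 : τ 0 = p' := Subtype.ext (by simp [τ])
  have hev : ∀ᶠ t in nhds (0 : ℝ), τ t ∈ interior ((↑) ⁻¹' C : Set (affineSpan ℝ C)) :=
    hτ.continuousAt.eventually_mem (by rw [hτ0]; exact isOpen_interior.mem_nhds hp')
  obtain ⟨t, ht, ht0⟩ :=
    ((hev.filter_mono nhdsWithin_le_nhds).and (self_mem_nhdsWithin (s := Ioi (0 : ℝ)))).exists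
  have htC : AffineMap.lineMap (p' : E) w t ∈ C :=
    (interior_subset ht : τ t ∈ ((↑) ⁻¹' C : Set (affineSpan ℝ C)))
  have hin := inner_sub_nonpos_of_dist_eq_infDist hC hp h _ htC
  rw [AffineMap.lineMap_apply, vsub_eq_sub, vadd_eq_add, add_sub_cancel_right, inner_smul_right,
    real_inner_self_eq_norm_sq] at hin
  have hpos : 0 < ‖w - p'‖ := norm_pos_iff.2 (sub_ne_zero.2 fun h => hwC (h ▸ hp))
  exact absurd hin (not_le.2 (mul_pos ht0 (pow_pos hpos 2)))

end NearestPoint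

section ParallelHypersurface

variable {E : Type*} [NormedAddCommGroup E] [InnerProductSpace ℝ E] {C : Set E}

lemma norm_radial_sub_radial_le {a b : E} (ha : a ≠ 0) (hb : b ≠ 0) {R : ℝ} (hR : 0 ≤ R) :
    ‖(R / ‖a‖) • a - (R / ‖b‖) • b‖ ≤ 2 * (R / ‖a‖) * ‖a - b‖ := by
  have ha' : 0 < ‖a‖ := norm_pos_iff.2 ha
  have hb' : 0 < ‖b‖ := norm_pos_iff.2 hb
  have e : (R / ‖a‖) • a - (R / ‖b‖) • b
      = (R / ‖a‖) • (a - b) + ((R / ‖a‖) * ((‖b‖ - ‖a‖) / ‖b‖)) • b := by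
    have : (R / ‖a‖) * ((‖b‖ - ‖a‖) / ‖b‖) = R / ‖a‖ - R / ‖b‖ := by field_simp
    rw [this]
    module
  rw [e]
  refine (norm_add_le _ _).trans ?_
  have h1 : ‖(R / ‖a‖) • (a - b)‖ = (R / ‖a‖) * ‖a - b‖ := by
    rw [norm_smul, Real.norm_of_nonneg (by positivity)]
  have h2 : ‖((R / ‖a‖) * ((‖b‖ - ‖a‖) / ‖b‖)) • b‖ = (R / ‖a‖) * |‖b‖ - ‖a‖| := by
    rw [norm_smul, Real.norm_eq_abs, abs_mul, abs_of_nonneg (by positivity : 0 ≤ R / ‖a‖), abs_div,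
      abs_of_pos hb']
    field_simp
  have h3 : |‖b‖ - ‖a‖| ≤ ‖a - b‖ := by
    rw [norm_sub_rev]
    exact abs_norm_sub_norm_le b a
  rw [h1, h2]
  nlinarith [mul_le_mul_of_nonneg_left h3 (by positivity : 0 ≤ R / ‖a‖)]

/-- Two outward normals of length `R` at the same point making a non-obtuse angle are joined
in the parallel hypersurface by an arc of length at most `8 R`. -/
lemma lengthDist_normal_le {p v w : E} {R : ℝ} (hR : 0 < R) (hp : p ∈ C)
    (hv : ∀ q ∈ C, ⟪v, q - p⟫ ≤ 0) (hw : ∀ q ∈ C, ⟪w, q - p⟫ ≤ 0) (hvR : ‖v‖ = R)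
    (hwR : ‖w‖ = R) (hvw : 0 ≤ ⟪v, w⟫) :
    lengthDist {u | infDist u C = R} (p + v) (p + w) ≤ ENNReal.ofReal (8 * R) := by
  set g : ℝ → E := fun t => (1 - t) • v + t • w with hg
  have hgn : ∀ t ∈ Icc (0 : ℝ) 1, R / 2 ≤ ‖g t‖ := by
    intro t ht
    rw [← sq_le_sq₀ (by positivity) (norm_nonneg _), hg]
    dsimp only
    rw [norm_add_sq_real, norm_smul, norm_smul, inner_smul_left, inner_smul_right, hvR, hwR,
      Real.norm_of_nonneg ht.1, Real.norm_of_nonneg (sub_nonneg.2 ht.2)]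
    have : 0 ≤ (1 - t) * (t * ⟪v, w⟫) :=
      mul_nonneg (sub_nonneg.2 ht.2) (mul_nonneg ht.1 hvw)
    simp only [conj_trivial]
    nlinarith [mul_nonneg (sq_nonneg R) (sq_nonneg (2 * t - 1))]
  have hg0 : ∀ t ∈ Icc (0 : ℝ) 1, 0 < ‖g t‖ := fun t ht => (half_pos hR).trans_le (hgn t ht)
  refine lengthDist_le_of_lipschitz (γ := fun t => p + (R / ‖g t‖) • g t) (by positivity)
    ?_ ?_ ?_ ?_
  · intro s hs t ht
    rw [dist_add_left, dist_eq_norm, Real.dist_eq]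
    refine (norm_radial_sub_radial_le (norm_pos_iff.1 (hg0 s hs)) (norm_pos_iff.1 (hg0 t ht))
      hR.le).trans ?_
    have h1 : R / ‖g s‖ ≤ 2 := by
      rw [div_le_iff₀ (hg0 s hs)]
      linarith [hgn s hs]
    have h2 : ‖g s - g t‖ ≤ |s - t| * (2 * R) := by
      have : g s - g t = (s - t) • (w - v) := by
        simp only [hg]
        module
      rw [this, norm_smul, Real.norm_eq_abs]
      gcongr
      linarith [norm_sub_le w v]
    calc 2 * (R / ‖g s‖) * ‖g s - g t‖ ≤ 2 * 2 * (|s - t| * (2 * R)) := by gcongr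
      _ = 8 * R * |s - t| := by ring
  · simp [hg, hvR, hR.ne']
  · simp [hg, hwR, hR.ne']
  · intro t ht
    have hn : ‖(R / ‖g t‖) • g t‖ = R := by
      rw [norm_smul, norm_div, norm_norm, Real.norm_of_nonneg hR.le,
        div_mul_cancel₀ _ (hg0 t ht).ne']
    refine (infDist_add_eq_norm hp fun q hq => ?_).trans hn
    rw [inner_smul_left]
    refine mul_nonpos_of_nonneg_of_nonpos (by simp; positivity) ?_
    simp only [hg, inner_add_left, inner_smul_left, conj_trivial]
    nlinarith [mul_nonneg (sub_nonneg.2 ht.2) (neg_nonneg.2 (hv q hq)),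
      mul_nonneg ht.1 (neg_nonneg.2 (hw q hq))]

/-- A segment of `C` can be pushed to the parallel hypersurface along a common normal. -/
lemma lengthDist_translate_le (hC : Convex ℝ C) {p q v : E} {R : ℝ} (hp : p ∈ C) (hq : q ∈ C)
    (hv : ∀ a ∈ C, ∀ b ∈ C, ⟪v, b - a⟫ = 0) (hvR : ‖v‖ = R) :
    lengthDist {u | infDist u C = R} (p + v) (q + v) ≤ ENNReal.ofReal (dist p q) := by
  refine lengthDist_le_of_lipschitz (γ := fun t => AffineMap.lineMap p q t + v) dist_nonneg
    ?_ (by simp) (by simp) ?_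
  · intro s _ t _
    rw [dist_add_right, dist_lineMap_lineMap, mul_comm]
  · intro t ht
    have hmem : AffineMap.lineMap p q t ∈ C := hC.lineMap_mem hp hq ht
    exact (infDist_add_eq_norm hmem fun b hb => (hv _ hmem b hb).le).trans hvR

end ParallelHypersurface

section Hyperplane

variable {E : Type*} [NormedAddCommGroup E] [InnerProductSpace ℝ E]

lemma exists_unit_normal [FiniteDimensional ℝ E] {K : Submodule ℝ E}
    (hK : Module.finrank ℝ K + 1 = Module.finrank ℝ E) :
    ∃ e : E, ‖e‖ = 1 ∧ ∀ w, w ∈ K ↔ ⟪e, w⟫ = 0 := by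
  obtain ⟨v, hv0, hv⟩ := finrank_eq_one_iff'.1 (Submodule.finrank_add_finrank_orthogonal' hK)
  have hv0' : (v : E) ≠ 0 := fun h => hv0 (Subtype.ext h)
  refine ⟨(‖(v : E)‖⁻¹) • (v : E), norm_smul_inv_norm hv0', fun w => ?_⟩
  rw [inner_smul_left, mul_eq_zero]
  constructor
  · exact fun hw => Or.inr (Submodule.inner_left_of_mem_orthogonal hw v.2)
  · rintro (h | h)
    · simp [hv0'] at h
    · rw [← K.orthogonal_orthogonal, Submodule.mem_orthogonal]
      intro u hu
      obtain ⟨c, hc⟩ := hv ⟨u, hu⟩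
      have : u = c • (v : E) := by simpa using (congrArg Subtype.val hc).symm
      rw [this, inner_smul_left, h, mul_zero]

lemma inner_sub_eq_zero_of_dist_eq_infDist {Φ : AffineSubspace ℝ E} {x p : E} (hp : p ∈ Φ)
    (h : dist x p = infDist x (Φ : Set E)) {w : E} (hw : w ∈ Φ.direction) : ⟪x - p, w⟫ = 0 := by
  have key : ∀ w ∈ Φ.direction, ⟪x - p, w⟫ ≤ 0 := fun w hw => by
    simpa using inner_sub_nonpos_of_dist_eq_infDist Φ.convex hp h (w + p)
      (AffineSubspace.vadd_mem_of_mem_direction hw hp)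
  have := key (-w) (neg_mem hw)
  rw [inner_neg_right] at this
  linarith [key w hw]

/-- The signed heights of two points strictly on opposite sides of a hyperplane have
opposite signs. -/
lemma inner_mul_inner_neg_of_sOppSide {Φ : AffineSubspace ℝ E} {e : E}
    (he : ∀ w, w ∈ Φ.direction ↔ ⟪e, w⟫ = 0) {x y p : E} (hp : p ∈ Φ) (h : Φ.SOppSide x y) :
    ⟪e, x - p⟫ * ⟪e, y - p⟫ < 0 := by
  have hne : ∀ w, w ∉ Φ → ⟪e, w - p⟫ ≠ 0 := fun w hw h0 =>
    hw ((AffineSubspace.vsub_right_mem_direction_iff_mem hp w).1 ((he _).2 h0))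
  obtain ⟨hwo, hx, hy⟩ := h
  obtain ⟨m, hm, t, ht, rfl⟩ := AffineSubspace.wOppSide_iff_exists_wbtw.1 hwo
  have hm0 := (he _).1 (Φ.vsub_mem_direction hm hp)
  have e1 : AffineMap.lineMap x y t -ᵥ p = (1 - t) • (x - p) + t • (y - p) := by
    rw [AffineMap.lineMap_apply, vsub_eq_sub, vadd_eq_add, vsub_eq_sub]
    module
  rw [e1, inner_add_right, inner_smul_right, inner_smul_right] at hm0
  have hx0 := hne x hx
  have hy0 := hne y hy
  generalize ⟪e, x - p⟫ = a at *
  generalize ⟪e, y - p⟫ = b at *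
  by_contra! hab
  have hab' : 0 < a * b := lt_of_le_of_ne hab (mul_ne_zero hx0 hy0).symm
  have h1 : (1 - t) * (a * b) + t * b ^ 2 = 0 := by linear_combination b * hm0
  have hb2 : 0 < b ^ 2 := by positivity
  rcases ht.1.eq_or_lt with h0 | h0
  · subst h0
    linarith
  · nlinarith [mul_nonneg (sub_nonneg.2 ht.2) hab'.le, mul_pos h0 hb2]

end Hyperplane

section Polyhedron

variable {n : ℕ} {P : Set (EuclideanSpace ℝ (Fin n))}

lemma IsPolyhedron.convex (hP : IsPolyhedron P) : Convex ℝ P := by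
  obtain ⟨k, v, c, rfl⟩ := hP
  rw [ofPred_forall]
  exact convex_iInter fun i => convex_halfSpace_le (innerₗ _ (v i)).isLinear (c i)

lemma IsPolyhedron.isClosed (hP : IsPolyhedron P) : IsClosed P := by
  obtain ⟨k, v, c, rfl⟩ := hP
  rw [ofPred_forall]
  exact isClosed_iInter fun i => isClosed_le (by fun_prop) continuous_const

/-- At every relative boundary point a polyhedron has an outward unit normal that is tangent
to its affine span. -/
lemma IsPolyhedron.exists_unit_outward_normal (hP : IsPolyhedron P) {z : EuclideanSpace ℝ (Fin n)}
    (hz : z ∈ intrinsicFrontier ℝ P) :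
    ∃ u ∈ (affineSpan ℝ P).direction, ‖u‖ = 1 ∧ ∀ q ∈ P, ⟪u, q - z⟫ ≤ 0 := by
  have hzP : z ∈ P := intrinsicFrontier_subset hP.isClosed hz
  obtain ⟨k, v, c, hPeq⟩ := hP
  have hmem : ∀ w, w ∈ P ↔ ∀ i, ⟪v i, w⟫ ≤ c i := fun w => by rw [hPeq]; rfl
  obtain ⟨i, hi, d, hd, hid⟩ : ∃ i, ⟪v i, z⟫ = c i ∧
      ∃ d ∈ (affineSpan ℝ P).direction, ⟪v i, d⟫ ≠ 0 := by
    by_contra! hcon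
    rw [← intrinsicClosure_sdiff_intrinsicInterior] at hz
    refine hz.2 (mem_intrinsicInterior.2 ⟨⟨z, subset_affineSpan ℝ P hzP⟩, ?_, rfl⟩)
    rw [mem_interior_iff_mem_nhds]
    have hopen : ∀ i, ∀ᶠ w : affineSpan ℝ P in nhds ⟨z, subset_affineSpan ℝ P hzP⟩,
        ⟪v i, (w : EuclideanSpace ℝ (Fin n))⟫ ≤ c i := by
      intro i
      rcases ((hmem z).1 hzP i).eq_or_lt with h | h
      · refine Filter.Eventually.of_forall fun w => ?_
        have h0 := hcon i h _
          (AffineSubspace.vsub_mem_direction w.2 (subset_affineSpan ℝ P hzP))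
        rw [vsub_eq_sub, inner_sub_right] at h0
        linarith
      · have hc : Continuous fun w : affineSpan ℝ P =>
            ⟪v i, (w : EuclideanSpace ℝ (Fin n))⟫ := by fun_prop
        filter_upwards [hc.continuousAt.eventually_lt continuousAt_const h] with w hw
        exact hw.le
    filter_upwards [Filter.eventually_all.2 hopen] with w hw
    exact (hmem w).2 hw
  obtain ⟨a, ha, b, hb, hab⟩ :=
    (affineSpan ℝ P).direction.exists_add_mem_mem_orthogonal (v i)
  have hva : ∀ w ∈ (affineSpan ℝ P).direction, ⟪v i, w⟫ = ⟪a, w⟫ := fun w hw => by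
    rw [hab, inner_add_left, Submodule.inner_left_of_mem_orthogonal hw hb, add_zero]
  have ha0 : a ≠ 0 := by
    rintro rfl
    exact hid (by rw [hva d hd, inner_zero_left])
  refine ⟨(‖a‖⁻¹) • a, Submodule.smul_mem _ _ ha, norm_smul_inv_norm ha0, fun q hq => ?_⟩
  have hqz : q - z ∈ (affineSpan ℝ P).direction :=
    AffineSubspace.vsub_mem_direction (subset_affineSpan ℝ P hq) (subset_affineSpan ℝ P hzP)
  rw [inner_smul_left, ← hva _ hqz, inner_sub_right]
  refine mul_nonpos_of_nonneg_of_nonpos (by simp) ?_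
  linarith [(hmem q).1 hq i]

end Polyhedron

section Comparison

variable {E : Type*} [NormedAddCommGroup E] [InnerProductSpace ℝ E] {C : Set E} {e : E}

lemma le_two_mul_lengthDist [ProperSpace E] (hC : Convex ℝ C) (hcl : IsClosed C)
    (he : ∀ w, w ∈ (affineSpan ℝ C).direction ↔ ⟪e, w⟫ = 0) {R : ℝ} (hR : 0 < R)
    {x y x₀ y₀ z : E} (hopp : (affineSpan ℝ C).SOppSide x y)
    (hx₀ : x₀ ∈ C) (hx : dist x x₀ = infDist x C) (hy₀ : y₀ ∈ C) (hy : dist y y₀ = infDist y C)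
    (hz : ∀ t ∈ intrinsicFrontier ℝ C, dist x₀ z + dist z y₀ ≤ dist x₀ t + dist t y₀) :
    ENNReal.ofReal (1 / 2 * (dist x y + dist x₀ z + dist z y₀)) ≤
      lengthDist {w | infDist w C = R} x y := by
  refine le_iInf fun γ => le_iInf fun hc => le_iInf fun h0 => le_iInf fun h1 =>
    le_iInf fun hS => ?_
  have hsign := inner_mul_inner_neg_of_sOppSide he (subset_affineSpan ℝ C hx₀) hopp
  obtain ⟨t, ht, hft⟩ : ∃ t ∈ Icc (0 : ℝ) 1, ⟪e, γ t - x₀⟫ = 0 := by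
    have hf : ContinuousOn (fun t => ⟪e, γ t - x₀⟫) (uIcc 0 1) := by
      rw [uIcc_of_le zero_le_one]
      fun_prop
    have hmem : (0 : ℝ) ∈ uIcc ⟪e, γ 0 - x₀⟫ ⟪e, γ 1 - x₀⟫ := by
      rw [h0, h1, mem_uIcc]
      rcases mul_neg_iff.1 hsign with h | h
      · exact Or.inr ⟨h.2.le, h.1.le⟩
      · exact Or.inl ⟨h.1.le, h.2.le⟩
    obtain ⟨t, ht, hft⟩ := intermediate_value_uIcc hf hmem
    exact ⟨t, by rwa [uIcc_of_le zero_le_one] at ht, hft⟩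
  have hwΦ : γ t ∈ affineSpan ℝ C :=
    (AffineSubspace.vsub_right_mem_direction_iff_mem (subset_affineSpan ℝ C hx₀) _).1
      ((he _).2 hft)
  have hwC : γ t ∉ C := fun h => by
    have := hS t ht
    rw [mem_ofPred_eq, infDist_zero_of_mem h] at this
    exact hR.ne this
  obtain ⟨w₀, hw₀, hw⟩ := hcl.exists_infDist_eq_dist ⟨x₀, hx₀⟩ (γ t)
  have hw₀F := mem_intrinsicFrontier_of_dist_eq_infDist hC hwΦ hwC hw₀ hw.symm
  have hxn := inner_sub_nonpos_of_dist_eq_infDist hC hx₀ hx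
  have hyn := inner_sub_nonpos_of_dist_eq_infDist hC hy₀ hy
  have hwn := inner_sub_nonpos_of_dist_eq_infDist hC hw₀ hw.symm
  have d1 := dist_le_dist_of_inner_nonpos (hxn _ hw₀) (hwn _ hx₀)
  have d2 := dist_le_dist_of_inner_nonpos (hwn _ hy₀) (hyn _ hw₀)
  refine le_trans ?_ (edist_add_edist_le_eVariationOn γ ht)
  rw [h0, h1, edist_dist, edist_dist, ← ENNReal.ofReal_add dist_nonneg dist_nonneg]
  apply ENNReal.ofReal_le_ofReal
  linarith [hz w₀ hw₀F, dist_triangle x (γ t) y]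

/-- The path goes from `x` up to the normal over `x₀`, along the upper copy of `C`, around the
boundary point `z`, and back along the lower copy of `C` to `y`. -/
lemma lengthDist_le_of_outward_normal (hC : Convex ℝ C) (hen : ‖e‖ = 1)
    (he : ∀ a ∈ C, ∀ b ∈ C, ⟪e, b - a⟫ = 0) {R : ℝ} (hR : 0 < R) {x y x₀ y₀ z u : E}
    (hx₀ : x₀ ∈ C) (hx : dist x x₀ = infDist x C) (hxR : infDist x C = R)
    (hy₀ : y₀ ∈ C) (hy : dist y y₀ = infDist y C) (hyR : infDist y C = R)
    (hxe : 0 ≤ ⟪e, x - x₀⟫) (hye : ⟪e, y - y₀⟫ ≤ 0) (hz : z ∈ C) (hu : ‖u‖ = 1)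
    (heu : ⟪e, u⟫ = 0) (hun : ∀ q ∈ C, ⟪u, q - z⟫ ≤ 0) :
    lengthDist {w | infDist w C = R} x y ≤
      ENNReal.ofReal (32 * R + dist x₀ z + dist z y₀) := by
  have hxn := inner_sub_nonpos_of_dist_eq_infDist hC hx₀ hx
  have hyn := inner_sub_nonpos_of_dist_eq_infDist hC hy₀ hy
  have hxR' : ‖x - x₀‖ = R := by rw [← dist_eq_norm, hx, hxR]
  have hyR' : ‖y - y₀‖ = R := by rw [← dist_eq_norm, hy, hyR]
  have hRe : ‖R • e‖ = R := by rw [norm_smul, hen, mul_one, Real.norm_of_nonneg hR.le]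
  have hRe' : ‖-(R • e)‖ = R := by rw [norm_neg, hRe]
  have hRu : ‖R • u‖ = R := by rw [norm_smul, hu, mul_one, Real.norm_of_nonneg hR.le]
  have hpos : ∀ a ∈ C, ∀ b ∈ C, ⟪R • e, b - a⟫ = 0 := fun a ha b hb => by
    rw [inner_smul_left, he a ha b hb, mul_zero]
  have hneg : ∀ a ∈ C, ∀ b ∈ C, ⟪-(R • e), b - a⟫ = 0 := fun a ha b hb => by
    rw [inner_neg_left, hpos a ha b hb, neg_zero]
  have hunR : ∀ q ∈ C, ⟪R • u, q - z⟫ ≤ 0 := fun q hq => by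
    rw [inner_smul_left]
    exact mul_nonpos_of_nonneg_of_nonpos hR.le (hun q hq)
  have hue : ⟪R • e, R • u⟫ = 0 := by
    rw [inner_smul_left, inner_smul_right, heu, mul_zero, mul_zero]
  have arc₁ := lengthDist_normal_le hR hx₀ hxn (fun q hq => (hpos _ hx₀ q hq).le) hxR' hRe
    (by rw [inner_smul_right, real_inner_comm]; exact mul_nonneg hR.le hxe)
  have seg₁ := lengthDist_translate_le hC hx₀ hz hpos hRe
  have arc₂ := lengthDist_normal_le hR hz (fun q hq => (hpos _ hz q hq).le) hunR hRe hRu hue.ge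
  have arc₃ := lengthDist_normal_le hR hz hunR (fun q hq => (hneg _ hz q hq).le) hRu hRe'
    (by rw [inner_neg_right, real_inner_comm, hue, neg_zero])
  have seg₂ := lengthDist_translate_le hC hz hy₀ hneg hRe'
  have arc₄ := lengthDist_normal_le hR hy₀ (fun q hq => (hneg _ hy₀ q hq).le) hyn hRe' hyR'
    (by
      rw [inner_neg_left, inner_smul_left]
      exact neg_nonneg.2 (mul_nonpos_of_nonneg_of_nonpos hR.le hye))
  rw [add_sub_cancel] at arc₁ arc₄
  have h8 : 0 ≤ 8 * R := by positivity
  have hsum : ENNReal.ofReal (32 * R + dist x₀ z + dist z y₀) =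
      ENNReal.ofReal (8 * R) + (ENNReal.ofReal (dist x₀ z) + (ENNReal.ofReal (8 * R) +
        (ENNReal.ofReal (8 * R) + (ENNReal.ofReal (dist z y₀) + ENNReal.ofReal (8 * R))))) := by
    rw [← ENNReal.ofReal_add (by positivity) h8, ← ENNReal.ofReal_add h8 (by positivity),
      ← ENNReal.ofReal_add h8 (by positivity), ← ENNReal.ofReal_add dist_nonneg (by positivity),
      ← ENNReal.ofReal_add h8 (by positivity)]
    congr 1
    ring
  rw [hsum]
  refine (lengthDist_triangle _ _ _ _).trans (add_le_add arc₁ ?_)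
  refine (lengthDist_triangle _ _ _ _).trans (add_le_add seg₁ ?_)
  refine (lengthDist_triangle _ _ _ _).trans (add_le_add arc₂ ?_)
  refine (lengthDist_triangle _ _ _ _).trans (add_le_add arc₃ ?_)
  exact (lengthDist_triangle _ _ _ _).trans (add_le_add seg₂ arc₄)

/-- If the segment between the projections of `x` and `y` to the hyperplane meets `C`, then
`x` and `y` are at least as far apart as `x` is from `C`. -/
lemma infDist_le_dist_of_sOppSide
    (he : ∀ w, w ∈ (affineSpan ℝ C).direction ↔ ⟪e, w⟫ = 0) (hen : ‖e‖ = 1) {x y x' y' : E}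
    (hopp : (affineSpan ℝ C).SOppSide x y)
    (hx' : x' ∈ affineSpan ℝ C) (hx : dist x x' = infDist x (affineSpan ℝ C : Set E))
    (hy' : y' ∈ affineSpan ℝ C) (hy : dist y y' = infDist y (affineSpan ℝ C : Set E))
    (hseg : (segment ℝ x' y' ∩ C).Nonempty) : infDist x C ≤ dist x y := by
  obtain ⟨p, ⟨a, b, ha, hb, hab, rfl⟩, hpC⟩ := hseg
  set p := a • x' + b • y' with hp
  have hpΦ : p ∈ affineSpan ℝ C := subset_affineSpan ℝ C hpC
  have hxo := fun w hw => inner_sub_eq_zero_of_dist_eq_infDist hx' hx (w := w) hw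
  have hyo := fun w hw => inner_sub_eq_zero_of_dist_eq_infDist hy' hy (w := w) hw
  have hxp : x' - p ∈ (affineSpan ℝ C).direction := AffineSubspace.vsub_mem_direction hx' hpΦ
  have hyp : y' - p ∈ (affineSpan ℝ C).direction := AffineSubspace.vsub_mem_direction hy' hpΦ
  have hheight : ⟪x - x', y - y'⟫ ≤ 0 := by
    have hsign := inner_mul_inner_neg_of_sOppSide he hpΦ hopp
    have hxe : ⟪e, x - p⟫ = ⟪e, x - x'⟫ := by
      rw [← sub_add_sub_cancel x x' p, inner_add_right, (he _).1 hxp, add_zero]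
    have hye : ⟪e, y - p⟫ = ⟪e, y - y'⟫ := by
      rw [← sub_add_sub_cancel y y' p, inner_add_right, (he _).1 hyp, add_zero]
    have hdir : y - y' - ⟪e, y - y'⟫ • e ∈ (affineSpan ℝ C).direction := by
      rw [he, inner_sub_right, inner_smul_right, real_inner_self_eq_norm_sq, hen]
      ring
    have h0 := hxo _ hdir
    rw [inner_sub_right, inner_smul_right, real_inner_comm, real_inner_comm e] at h0
    rw [hxe, hye] at hsign
    rw [real_inner_comm]
    linarith
  have hflat : ⟪x' - p, y' - p⟫ ≤ 0 := by
    have ha' : a = 1 - b := by linarith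
    have e1 : x' - p = b • (x' - y') := by
      rw [hp, ha']
      module
    have e2 : y' - p = -((1 - b) • (x' - y')) := by
      rw [hp, ha']
      module
    rw [e1, e2, inner_neg_right, inner_smul_left, inner_smul_right, real_inner_self_eq_norm_sq,
      ← ha']
    simp only [conj_trivial]
    have : 0 ≤ b * (a * ‖x' - y'‖ ^ 2) := by positivity
    linarith
  have hin : ⟪x - p, y - p⟫ ≤ 0 := by
    rw [← sub_add_sub_cancel x x' p, ← sub_add_sub_cancel y y' p, inner_add_left,
      inner_add_right, inner_add_right, hxo _ hyp, real_inner_comm (y - y') (x' - p), hyo _ hxp]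
    linarith
  refine (infDist_le_dist_of_mem hpC).trans ?_
  rw [dist_eq_norm, dist_eq_norm, ← sq_le_sq₀ (norm_nonneg _) (norm_nonneg _)]
  have hsq := norm_sub_sq_real (x - p) (y - p)
  rw [sub_sub_sub_cancel_right] at hsq
  nlinarith [sq_nonneg ‖y - p‖]

end Comparison

/-- Lemma (separating case): for a convex polytope `P ≠ Φ` whose affine span `Φ` is a
hyperplane, points `x, y ∈ ∂N_R(P)` lying on opposite sides of `Φ`, with projections
`x₀, y₀` on `P` and `x', y'` on `Φ` such that `[x',y']` meets `P`, and `z` a point of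
the relative boundary of `P` minimizing `d(x₀,t)+d(t,y₀)`, satisfy
`k₁·(d(x,y)+d(x₀,z)+d(z,y₀)) ≤ d_ℓ(x,y) ≤ k₂·(d(x,y)+d(x₀,z)+d(z,y₀))`
for universal constants `k₁, k₂ > 0`. -/
theorem length_metric_comparable_separating :
    ∃ k₁ k₂ : ℝ, 0 < k₁ ∧ 0 < k₂ ∧
    ∀ (n : ℕ), 2 ≤ n →
    ∀ P : Set (EuclideanSpace ℝ (Fin n)), IsPolyhedron P → P.Nonempty →
      Module.finrank ℝ (affineSpan ℝ P).direction + 1 = n →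
      P ≠ (affineSpan ℝ P : Set (EuclideanSpace ℝ (Fin n))) →
    ∀ R : ℝ, 0 < R →
    ∀ x y : EuclideanSpace ℝ (Fin n),
      infDist x P = R → infDist y P = R →
      (affineSpan ℝ P).SOppSide x y →
    ∀ x₀ ∈ P, dist x x₀ = infDist x P →
    ∀ y₀ ∈ P, dist y y₀ = infDist y P →
    ∀ x' ∈ (affineSpan ℝ P : Set (EuclideanSpace ℝ (Fin n))),
      dist x x' = infDist x (affineSpan ℝ P : Set (EuclideanSpace ℝ (Fin n))) →
    ∀ y' ∈ (affineSpan ℝ P : Set (EuclideanSpace ℝ (Fin n))),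
      dist y y' = infDist y (affineSpan ℝ P : Set (EuclideanSpace ℝ (Fin n))) →
      (segment ℝ x' y' ∩ P).Nonempty →
    ∀ z ∈ intrinsicFrontier ℝ P,
      (∀ t ∈ intrinsicFrontier ℝ P, dist x₀ z + dist z y₀ ≤ dist x₀ t + dist t y₀) →
      ENNReal.ofReal (k₁ * (dist x y + dist x₀ z + dist z y₀)) ≤
          lengthDist {w | infDist w P = R} x y ∧
      lengthDist {w | infDist w P = R} x y ≤
          ENNReal.ofReal (k₂ * (dist x y + dist x₀ z + dist z y₀)) := by
  refine ⟨1 / 2, 32, by norm_num, by norm_num, ?_⟩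
  intro n _ P hP _ hdim _ R hR x y hxR hyR hopp x₀ hx₀ hx y₀ hy₀ hy x' hx' hxx' y' hy' hyy'
    hseg z hz hmin
  obtain ⟨e, hen, he⟩ := exists_unit_normal (K := (affineSpan ℝ P).direction) (by simpa using hdim)
  refine ⟨le_two_mul_lengthDist hP.convex hP.isClosed he hR hopp hx₀ hx hy₀ hy hmin, ?_⟩
  have hRd : R ≤ dist x y :=
    hxR ▸ infDist_le_dist_of_sOppSide he hen hopp hx' hxx' hy' hyy' hseg
  obtain ⟨u, huK, hu, hun⟩ := hP.exists_unit_outward_normal hz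
  have hflat : ∀ a ∈ P, ∀ b ∈ P, ⟪e, b - a⟫ = 0 := fun a ha b hb =>
    (he _).1 (AffineSubspace.vsub_mem_direction (subset_affineSpan ℝ P hb)
      (subset_affineSpan ℝ P ha))
  have hzP := intrinsicFrontier_subset hP.isClosed hz
  have hsign := inner_mul_inner_neg_of_sOppSide he (subset_affineSpan ℝ P hx₀) hopp
  have hye : ⟪e, y - y₀⟫ = ⟪e, y - x₀⟫ := by
    rw [← sub_add_sub_cancel y y₀ x₀, inner_add_right, hflat _ hx₀ _ hy₀, add_zero]
  have hlen : lengthDist {w | infDist w P = R} x y ≤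
      ENNReal.ofReal (32 * R + dist x₀ z + dist z y₀) := by
    rcases mul_neg_iff.1 hsign with h | h
    · exact lengthDist_le_of_outward_normal hP.convex hen hflat hR hx₀ hx hxR hy₀ hy hyR h.1.le
        (hye ▸ h.2.le) hzP hu ((he u).1 huK) hun
    · refine lengthDist_le_of_outward_normal (e := -e) hP.convex (by rw [norm_neg, hen])
        (fun a ha b hb => by rw [inner_neg_left, hflat a ha b hb, neg_zero]) hR hx₀ hx hxR hy₀ hy
        hyR ?_ ?_ hzP hu (by rw [inner_neg_left, (he u).1 huK, neg_zero]) hun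
      · rw [inner_neg_left]
        exact neg_nonneg.2 h.1.le
      · rw [inner_neg_left, hye]
        exact neg_nonpos.2 h.2.le
  refine hlen.trans (ENNReal.ofReal_le_ofReal ?_)
  linarith [dist_nonneg (x := x₀) (y := z), dist_nonneg (x := z) (y := y₀)]
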